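/- Let n ≥ 1 and let L ⊆ ℝⁿ × ℝⁿ be compact. Let S and S_k (k ∈ ℕ) be C¹ functions ℝⁿ × ℝⁿ → ℝ with support contained in L, each satisfying: for every η ∈ ℝⁿ the map x ↦ x + ∇_η S(x,η) is injective, and for every x ∈ ℝⁿ the map η ↦ η + ∇_x S(x,η) is injective (and likewise with S replaced by each S_k). Let φ and φ_k be the unique homeomorphisms of ℝⁿ × ℝⁿ generated by S and by S_k respectively. If the total derivatives dS_k converge to dS uniformly on ℝⁿ × ℝⁿ, then φ_k → φ uniformly on ℝⁿ × ℝⁿ. -/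

import Mathlib

open Filter

/-- `φ` is generated by `S` (in the explicit Weinstein chart of `ℝ²ⁿ`) if
`φ (x, η + ∇ₓS(x,η)) = (x + ∇_η S(x,η), η)` for all `(x, η)`. -/
def GeneratedBy {n : ℕ}
    (S : EuclideanSpace ℝ (Fin n) × EuclideanSpace ℝ (Fin n) → ℝ)
    (φ : EuclideanSpace ℝ (Fin n) × EuclideanSpace ℝ (Fin n) →
         EuclideanSpace ℝ (Fin n) × EuclideanSpace ℝ (Fin n)) : Prop :=
  ∀ x η : EuclideanSpace ℝ (Fin n),
    φ (x, η + gradient (fun x' => S (x', η)) x) =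
      (x + gradient (fun η' => S (x, η')) η, η)

/-- The admissibility (injectivity) conditions on a generating function `S`. -/
def AdmissibleInj {n : ℕ}
    (S : EuclideanSpace ℝ (Fin n) × EuclideanSpace ℝ (Fin n) → ℝ) : Prop :=
  (∀ η : EuclideanSpace ℝ (Fin n),
    Function.Injective fun x => x + gradient (fun η' => S (x, η')) η) ∧
  (∀ x : EuclideanSpace ℝ (Fin n),
    Function.Injective fun η => η + gradient (fun x' => S (x', η)) x)

open Set Metric MeasureTheory Topology

section SmoothRetraction

variable {E : Type*} [NormedAddCommGroup E] [InnerProductSpace ℝ E]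

/-- A Lipschitz map on a closed ball vanishing on its boundary sphere extends by zero
to a Lipschitz map. -/
theorem LipschitzOnWith.indicator_closedBall {h : E → E} {ρ : ℝ} {C : NNReal}
    (hC : LipschitzOnWith C h (closedBall 0 ρ)) (h0 : ∀ x, ‖x‖ = ρ → h x = 0) :
    LipschitzWith C ((closedBall (0 : E) ρ).indicator h) := by
  have key : ∀ x y : E, ‖x‖ ≤ ρ → ρ < ‖y‖ → ‖h x‖ ≤ C * dist x y := by
    intro x y hx hy
    have hcont : ContinuousOn (fun t : ℝ => ‖AffineMap.lineMap x y t‖) (Icc 0 1) := by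
      apply Continuous.continuousOn
      exact (AffineMap.lineMap_continuous (p := x) (q := y)).norm
    obtain ⟨t, ht, hz⟩ := intermediate_value_Icc zero_le_one hcont
      (show ρ ∈ Icc _ _ by simpa using ⟨hx, hy.le⟩)
    have hz' : ‖AffineMap.lineMap x y t‖ = ρ := hz
    have h1 := hC.dist_le_mul x (by simpa using hx) (AffineMap.lineMap x y t)
      (by simpa using hz'.le)
    rw [h0 _ hz', dist_zero_right] at h1
    refine h1.trans (mul_le_mul_of_nonneg_left ?_ C.2)
    rw [dist_left_lineMap, Real.norm_of_nonneg ht.1]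
    exact mul_le_of_le_one_left dist_nonneg ht.2
  refine LipschitzWith.of_dist_le_mul fun x y => ?_
  by_cases hx : x ∈ closedBall (0 : E) ρ <;> by_cases hy : y ∈ closedBall (0 : E) ρ
  · rw [indicator_of_mem hx, indicator_of_mem hy]
    exact hC.dist_le_mul x hx y hy
  · rw [indicator_of_mem hx, indicator_of_notMem hy, dist_zero_right]
    exact key x y (by simpa using hx) (by simpa using hy)
  · rw [indicator_of_mem hy, indicator_of_notMem hx, dist_zero_left, dist_comm x y]
    exact key y x (by simpa using hy) (by simpa using hx)
  · rw [indicator_of_notMem hx, indicator_of_notMem hy]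
    simp only [dist_self]
    positivity

variable [FiniteDimensional ℝ E]

/-- `det (1 + t A)` is a polynomial in `t` of degree at most the dimension. -/
theorem exists_polynomial_det_one_add_smul (A : E →L[ℝ] E) :
    ∃ p : Polynomial ℝ, p.degree < (Module.finrank ℝ E + 1 : ℕ) ∧
      ∀ t : ℝ, (1 + t • A).det = p.eval t := by
  classical
  let b := Module.finBasis ℝ E
  let M := LinearMap.toMatrix b b (A : E →ₗ[ℝ] E)
  refine ⟨((Polynomial.X : Polynomial ℝ) • M.map Polynomial.C +
    (1 : Matrix _ _ ℝ).map Polynomial.C).det, ?_, fun t => ?_⟩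
  · refine lt_of_le_of_lt Polynomial.degree_le_natDegree ?_
    have := Polynomial.natDegree_det_X_add_C_le M 1
    rw [Fintype.card_fin] at this
    exact_mod_cast Nat.lt_succ_of_le this
  · have h : ((1 + t • A : E →L[ℝ] E) : E →ₗ[ℝ] E) = LinearMap.id + t • (A : E →ₗ[ℝ] E) := rfl
    rw [ContinuousLinearMap.det, h, ← LinearMap.det_toMatrix b, ← Polynomial.coe_evalRingHom,
      RingHom.map_det]
    congr 1
    ext i j
    rw [map_add, map_smul, LinearMap.toMatrix_id]
    by_cases hij : i = j <;> simp [M, hij] <;> ring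

/-- Small multiples of a Lipschitz displacement vanishing on the boundary sphere
yield bijections of the closed ball. -/
theorem bijOn_closedBall_add_smul {h : E → E} {ρ : ℝ} {C : NNReal}
    (hC : LipschitzOnWith C h (closedBall 0 ρ)) (h0 : ∀ x, ‖x‖ = ρ → h x = 0)
    {t : ℝ} (ht : 0 ≤ t) (htC : t * C < 1) :
    BijOn (fun x => x + t • h x) (closedBall 0 ρ) (closedBall 0 ρ) := by
  set H := (closedBall (0 : E) ρ).indicator h with hH
  have hL : LipschitzWith C H := hC.indicator_closedBall h0
  set G : E → E := fun x => x + t • H x with hG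
  have happ : ApproximatesLinearOn G ((ContinuousLinearEquiv.refl ℝ E : E ≃L[ℝ] E) : E →L[ℝ] E)
      univ (t.toNNReal * C) := by
    intro x _ y _
    have e : G x - G y - ((ContinuousLinearEquiv.refl ℝ E : E ≃L[ℝ] E) : E →L[ℝ] E) (x - y)
        = t • (H x - H y) := by
      simp only [hG, ContinuousLinearEquiv.coe_refl, ContinuousLinearMap.coe_id', id_eq, smul_sub]
      abel
    rw [e, norm_smul, Real.norm_of_nonneg ht, NNReal.coe_mul, Real.coe_toNNReal t ht, mul_assoc]
    exact mul_le_mul_of_nonneg_left (hL.norm_sub_le x y) ht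
  have hc : Subsingleton E ∨
      t.toNNReal * C < ‖((ContinuousLinearEquiv.refl ℝ E).symm : E →L[ℝ] E)‖₊⁻¹ := by
    rcases subsingleton_or_nontrivial E with hE | hE
    · exact Or.inl hE
    · right
      have : ‖((ContinuousLinearEquiv.refl ℝ E).symm : E →L[ℝ] E)‖₊ = 1 := by
        apply NNReal.eq
        simp
      rw [this, inv_one, ← NNReal.coe_lt_coe]
      simpa [Real.coe_toNNReal t ht] using htC
  have hinj : Function.Injective G := injOn_univ.1 (happ.injOn hc)
  have hsurj : Function.Surjective G := happ.surjective hc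
  have hout : ∀ x, x ∉ closedBall (0 : E) ρ → G x = x := fun x hx => by simp [hG, hH, hx]
  have heq : EqOn G (fun x => x + t • h x) (closedBall 0 ρ) := fun x hx => by
    simp [hG, hH, indicator_of_mem hx]
  refine BijOn.congr ⟨fun x hx => ?_, hinj.injOn, fun y hy => ?_⟩ heq
  · by_contra hGx
    exact hGx ((hinj (hout _ hGx)).symm ▸ hx)
  · obtain ⟨x, rfl⟩ := hsurj y
    refine ⟨x, ?_, rfl⟩
    by_contra hx
    exact hx (hout x hx ▸ hy)

theorem det_fderiv_eq_zero_of_norm_eq_const {r : E → E} {ρ : ℝ} (hρ : 0 < ρ)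
    (hr : Differentiable ℝ r) (hnorm : ∀ x, ‖r x‖ = ρ) (x : E) : (fderiv ℝ r x).det = 0 := by
  by_contra hdet
  have hsurj : Function.Surjective (fderiv ℝ r x) :=
    ((fderiv ℝ r x).toContinuousLinearEquivOfDetNeZero hdet).surjective
  obtain ⟨v, hv⟩ := hsurj (r x)
  have h1 := ((hr x).hasFDerivAt.norm_sq).fderiv
  have h2 : (fun y => ‖r y‖ ^ 2) = fun _ => ρ ^ 2 := by
    ext y
    rw [hnorm]
  rw [h2, fderiv_fun_const] at h1
  have h3 := congrArg (fun A : E →L[ℝ] ℝ => A v) h1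
  simp [hv, hnorm] at h3
  exact hρ.ne' h3

/-- There is no `C¹` retraction onto the boundary sphere of a ball. -/
theorem not_exists_contDiff_retraction_sphere {r : E → E} {ρ : ℝ} (hρ : 0 < ρ)
    (hr : ContDiff ℝ 1 r) (hnorm : ∀ x, ‖r x‖ = ρ) (hid : ∀ x, ‖x‖ = ρ → r x = x) : False := by
  borelize E
  set K : Set E := closedBall 0 ρ with hK
  have hKc : IsCompact K := isCompact_closedBall 0 ρ
  set h : E → E := fun x => r x - x with hh
  have hhC : ContDiff ℝ 1 h := hr.sub contDiff_id
  have hDcont : Continuous (fderiv ℝ h) := hhC.continuous_fderiv one_ne_zero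
  have hD : ∀ x, HasFDerivAt h (fderiv ℝ h x) x :=
    fun x => (hhC.differentiable one_ne_zero x).hasFDerivAt
  obtain ⟨C₀, hC₀⟩ := hKc.exists_bound_of_continuousOn hDcont.continuousOn
  set C : NNReal := C₀.toNNReal
  have hbound : ∀ x ∈ K, ‖fderiv ℝ h x‖₊ ≤ C := fun x hx =>
    NNReal.coe_le_coe.1 ((hC₀ x hx).trans (Real.le_coe_toNNReal C₀))
  have hLip : LipschitzOnWith C h K :=
    (convex_closedBall 0 ρ).lipschitzOnWith_of_nnnorm_fderiv_le
      (fun x _ => hhC.differentiable one_ne_zero x) hbound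
  have hzero : ∀ x, ‖x‖ = ρ → h x = 0 := fun x hx => sub_eq_zero.2 (hid x hx)
  obtain ⟨δ, hδ, hdetpos⟩ : ∃ δ > 0, ∀ A : E →L[ℝ] E, ‖A‖ < δ → 0 < (1 + A).det := by
    have hc : ContinuousAt (fun A : E →L[ℝ] E => (1 + A).det) 0 :=
      (ContinuousLinearMap.continuous_det.comp (continuous_const.add continuous_id)).continuousAt
    have h1 : (0 : ℝ) < (1 + (0 : E →L[ℝ] E)).det := by
      rw [add_zero]
      simp [ContinuousLinearMap.det]
    obtain ⟨δ, hδ, hb⟩ := Metric.eventually_nhds_iff.1 (hc.eventually (lt_mem_nhds h1))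
    exact ⟨δ, hδ, fun A hA => hb (by simpa using hA)⟩
  set P : ℝ → E → ℝ := fun t x => (1 + t • fderiv ℝ h x).det with hP
  have hPcont : ∀ t, Continuous (P t) := fun t =>
    ContinuousLinearMap.continuous_det.comp (continuous_const.add (hDcont.const_smul t))
  set τ : ℝ := min 1 δ / (C + 1) with hτ
  have hτpos : 0 < τ := by positivity
  have hvol : ∀ t, 0 < t → t < τ → ∫ x in K, P t x = volume.real K := by
    intro t ht htτ
    have htC' : t * (C + 1) < min 1 δ := (lt_div_iff₀ (by positivity)).1 htτ
    have htC : t * C < min 1 δ := by nlinarith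
    have hbij := bijOn_closedBall_add_smul hLip hzero ht.le (htC.trans_le (min_le_left _ _))
    have hder : ∀ x ∈ K, HasFDerivWithinAt (fun x => x + t • h x)
        (1 + t • fderiv ℝ h x) K x := fun x _ =>
      ((hasFDerivAt_id x).add ((hD x).const_smul t)).hasFDerivWithinAt
    have hcv := integral_image_eq_integral_abs_det_fderiv_smul volume hKc.measurableSet hder
      hbij.injOn (fun _ => (1 : ℝ))
    rw [hbij.image_eq] at hcv
    have hL : ∫ x in K, (1 : ℝ) = volume.real K := by simp
    rw [← hL, hcv]
    refine setIntegral_congr_fun hKc.measurableSet fun x hx => ?_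
    have hn : ‖t • fderiv ℝ h x‖ < δ := by
      rw [norm_smul, Real.norm_of_nonneg ht.le]
      refine lt_of_le_of_lt (mul_le_mul_of_nonneg_left ?_ ht.le) (htC.trans_le (min_le_right _ _))
      exact_mod_cast hbound x hx
    simp only [hP, smul_eq_mul, mul_one]
    exact (abs_of_pos (hdetpos _ hn)).symm
  have hP1 : ∀ x, P 1 x = 0 := by
    intro x
    have e : (1 : E →L[ℝ] E) + (1 : ℝ) • fderiv ℝ h x = fderiv ℝ r x := by
      have : fderiv ℝ h x = fderiv ℝ r x - 1 :=
        ((hr.differentiable one_ne_zero x).hasFDerivAt.sub (hasFDerivAt_id x)).fderiv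
      rw [this, one_smul]
      abel
    simp only [hP, e]
    exact det_fderiv_eq_zero_of_norm_eq_const hρ (hr.differentiable one_ne_zero) hnorm x
  set N := Module.finrank ℝ E + 1 with hN
  set v : ℕ → ℝ := fun i => τ / (i + 2) with hv
  have hvpos : ∀ i, 0 < v i := fun i => by positivity
  have hvlt : ∀ i, v i < τ := fun i => div_lt_self hτpos (by
    have : (0 : ℝ) ≤ i := i.cast_nonneg
    linarith)
  have hvinj : InjOn v (Finset.range N : Set ℕ) := by
    intro i _ j _ hij
    have hij' : τ / ((i : ℝ) + 2) = τ / (j + 2) := hij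
    field_simp at hij'
    exact_mod_cast (add_right_cancel hij').symm
  set w : ℕ → ℝ := fun i => (Lagrange.basis (Finset.range N) v i).eval 1 with hw
  have hwsum : ∑ i ∈ Finset.range N, w i = 1 := by
    have := Lagrange.sum_basis hvinj ⟨0, by simp [hN]⟩
    rw [hw, ← Polynomial.eval_finsetSum, this, Polynomial.eval_one]
  have hinterp : ∀ x, P 1 x = ∑ i ∈ Finset.range N, P (v i) x * w i := by
    intro x
    obtain ⟨p, hdeg, hp⟩ := exists_polynomial_det_one_add_smul (fderiv ℝ h x)
    have := Lagrange.eq_interpolate hvinj (f := p) (by simpa [hN] using hdeg)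
    simp only [hP, hp]
    conv_lhs => rw [this]
    simp [Lagrange.interpolate_apply, Polynomial.eval_finsetSum, hw]
  have hint : ∫ x in K, ∑ i ∈ Finset.range N, P (v i) x * w i = volume.real K := by
    rw [integral_finsetSum _ fun i _ =>
      (((hPcont _).continuousOn.integrableOn_compact hKc).mul_const _)]
    calc ∑ i ∈ Finset.range N, ∫ x in K, P (v i) x * w i
        = ∑ i ∈ Finset.range N, volume.real K * w i := by
          refine Finset.sum_congr rfl fun i _ => ?_
          rw [integral_mul_const, hvol _ (hvpos i) (hvlt i)]
      _ = volume.real K := by rw [← Finset.mul_sum, hwsum, mul_one]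
  simp only [← hinterp, hP1, integral_zero] at hint
  have hpos : 0 < volume.real K :=
    ENNReal.toReal_pos (measure_closedBall_pos volume 0 hρ).ne' hKc.measure_lt_top.ne
  exact hpos.ne hint

/-- A continuous self-map which is the identity outside a ball has no omitted value. -/
theorem surjective_of_continuous_of_eq_self_off_closedBall {g : E → E} (hg : Continuous g)
    {R : ℝ} (hR : ∀ x, R < ‖x‖ → g x = x) : Function.Surjective g := by
  intro y
  by_contra! hy
  set g' : E → E := fun x => g (x + y) - y with hg'
  have hg'c : Continuous g' := by fun_prop
  have hg'0 : ∀ x, g' x ≠ 0 := fun x => sub_ne_zero.2 (hy _)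
  set R' := |R| + ‖y‖ with hR'
  have hR'0 : 0 ≤ R' := by positivity
  have hg'id : ∀ x, R' < ‖x‖ → g' x = x := by
    intro x hx
    have h1 : ‖x‖ ≤ ‖x + y‖ + ‖y‖ := by simpa using norm_sub_le (x + y) y
    have h2 := le_abs_self R
    simp only [hg']
    rw [hR _ (by linarith), add_sub_cancel_right]
  obtain ⟨f, hf, hfg, hfeq, -⟩ := hg'c.exists_contDiff_approx_and_eqOn 1 (ε := fun x => ‖g' x‖)
    hg'c.norm (fun x => norm_pos_iff.2 (hg'0 x)) (S := (ball (0 : E) (R' + 1))ᶜ)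
    (U := (closedBall (0 : E) R')ᶜ) isOpen_ball.isClosed_compl
    (isClosed_closedBall.isOpen_compl.mem_nhdsSet.2
      (compl_subset_compl.2 (closedBall_subset_ball (by linarith))))
    (contDiffOn_id.congr fun x hx => hg'id x (by simpa using hx))
  have hf0 : ∀ x, f x ≠ 0 := by
    intro x hx
    have := hfg x
    rw [hx, dist_zero_left] at this
    exact lt_irrefl _ this
  set ρ := R' + 1 with hρ
  have hρ0 : 0 < ρ := by positivity
  refine not_exists_contDiff_retraction_sphere (r := fun x => (ρ / ‖f x‖) • f x) hρ0 ?_ ?_ ?_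
  · exact ((contDiff_const.div (ContDiff.norm ℝ hf hf0)
      fun x => norm_ne_zero_iff.2 (hf0 x)).smul hf)
  · intro x
    rw [norm_smul, norm_div, norm_norm, Real.norm_of_nonneg hρ0.le,
      div_mul_cancel₀ _ (norm_ne_zero_iff.2 (hf0 x))]
  · intro x hx
    have hfx : f x = x := by
      rw [hfeq (by simp [hx]), hg'id x (by rw [hx]; linarith)]
    simp only [hfx, hx, div_self hρ0.ne', one_smul]

end SmoothRetraction

section PartialGradients

variable {F G : Type*} [NormedAddCommGroup F] [InnerProductSpace ℝ F]
  [NormedAddCommGroup G] [InnerProductSpace ℝ G]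

theorem gradient_partial_fst [CompleteSpace F] {S : F × G → ℝ}
    (hS : Differentiable ℝ S) (x : F) (η : G) :
    gradient (fun x' => S (x', η)) x = (InnerProductSpace.toDual ℝ F).symm
      ((fderiv ℝ S (x, η)).comp (ContinuousLinearMap.inl ℝ F G)) := by
  rw [gradient]
  congr 1
  exact ((hS (x, η)).hasFDerivAt.comp x (hasFDerivAt_prodMk_left x η)).fderiv

theorem gradient_partial_snd [CompleteSpace G] {S : F × G → ℝ}
    (hS : Differentiable ℝ S) (x : F) (η : G) :
    gradient (fun η' => S (x, η')) η = (InnerProductSpace.toDual ℝ G).symm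
      ((fderiv ℝ S (x, η)).comp (ContinuousLinearMap.inr ℝ F G)) := by
  rw [gradient]
  congr 1
  exact ((hS (x, η)).hasFDerivAt.comp η (hasFDerivAt_prodMk_right x η)).fderiv

theorem dist_gradient_partial_fst_le [CompleteSpace F] {S T : F × G → ℝ} (hS : Differentiable ℝ S)
    (hT : Differentiable ℝ T) (x : F) (η : G) :
    dist (gradient (fun x' => S (x', η)) x) (gradient (fun x' => T (x', η)) x) ≤
      dist (fderiv ℝ S (x, η)) (fderiv ℝ T (x, η)) := by
  rw [gradient_partial_fst hS, gradient_partial_fst hT, LinearIsometryEquiv.dist_map,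
    dist_eq_norm, ← ContinuousLinearMap.sub_comp]
  refine (ContinuousLinearMap.opNorm_comp_le _ _).trans
    (le_of_le_of_eq ?_ (dist_eq_norm (E := F × G →L[ℝ] ℝ) _ _).symm)
  exact mul_le_of_le_one_right (norm_nonneg _) (ContinuousLinearMap.norm_inl_le_one ℝ F G)

theorem dist_gradient_partial_snd_le [CompleteSpace G] {S T : F × G → ℝ} (hS : Differentiable ℝ S)
    (hT : Differentiable ℝ T) (x : F) (η : G) :
    dist (gradient (fun η' => S (x, η')) η) (gradient (fun η' => T (x, η')) η) ≤
      dist (fderiv ℝ S (x, η)) (fderiv ℝ T (x, η)) := by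
  rw [gradient_partial_snd hS, gradient_partial_snd hT, LinearIsometryEquiv.dist_map,
    dist_eq_norm, ← ContinuousLinearMap.sub_comp]
  refine (ContinuousLinearMap.opNorm_comp_le _ _).trans
    (le_of_le_of_eq ?_ (dist_eq_norm (E := F × G →L[ℝ] ℝ) _ _).symm)
  exact mul_le_of_le_one_right (norm_nonneg _) (ContinuousLinearMap.norm_inr_le_one ℝ F G)

theorem surjective_add_gradient_partial_fst [FiniteDimensional ℝ F] {S : F × F → ℝ}
    (hS : ContDiff ℝ 1 S) (hc : HasCompactSupport S) (x : F) :
    Function.Surjective fun η => η + gradient (fun x' => S (x', η)) x := by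
  have hd := hS.differentiable one_ne_zero
  simp only [gradient_partial_fst hd]
  obtain ⟨R, hR⟩ := hc.isCompact.isBounded.exists_norm_le
  refine surjective_of_continuous_of_eq_self_off_closedBall (R := R) ?_ fun η hη => ?_
  · have h1 : Continuous fun η => fderiv ℝ S (x, η) :=
      (hS.continuous_fderiv one_ne_zero).comp (by fun_prop)
    exact continuous_id.add ((LinearIsometryEquiv.continuous _).comp (h1.clm_comp continuous_const))
  · have : (x, η) ∉ tsupport S := fun hmem =>
      absurd ((norm_snd_le (x, η)).trans (hR _ hmem)) (not_le.2 hη)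
    rw [fderiv_of_notMem_tsupport ℝ this]
    simp

end PartialGradients

theorem GeneratedBy.eq_self_of_notMem_tsupport {n : ℕ}
    {S : EuclideanSpace ℝ (Fin n) × EuclideanSpace ℝ (Fin n) → ℝ}
    {φ : EuclideanSpace ℝ (Fin n) × EuclideanSpace ℝ (Fin n) →
         EuclideanSpace ℝ (Fin n) × EuclideanSpace ℝ (Fin n)}
    (hφ : GeneratedBy S φ) (hS : Differentiable ℝ S)
    {p : EuclideanSpace ℝ (Fin n) × EuclideanSpace ℝ (Fin n)} (hp : p ∉ tsupport S) :
    φ p = p := by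
  have h := hφ p.1 p.2
  rw [gradient_partial_fst hS, gradient_partial_snd hS, fderiv_of_notMem_tsupport ℝ hp] at h
  simpa using h

/-- A continuous map equal to the identity off a compact set is uniformly continuous. -/
theorem Continuous.uniformContinuous_of_eq_self_off_compact {E : Type*} [NormedAddCommGroup E]
    {f : E → E} (hf : Continuous f) {K : Set E} (hK : IsCompact K) (h : ∀ x ∉ K, f x = x) :
    UniformContinuous f := by
  have h1 : HasCompactSupport fun x => f x - x :=
    HasCompactSupport.intro hK fun x hx => sub_eq_zero.2 (h x hx)
  have h2 := h1.uniformContinuous_of_continuous (hf.sub continuous_id)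
  simpa using h2.add uniformContinuous_id

/-- Lemma 3.2.1 (one direction): `C¹`-convergence of admissible generating functions,
all supported in a common compact set, implies uniform (`C⁰`) convergence of the
associated homeomorphisms. -/
theorem homeomorph_tendstoUniformly_of_fderiv_tendstoUniformly
    (n : ℕ) (hn : 1 ≤ n)
    (L : Set (EuclideanSpace ℝ (Fin n) × EuclideanSpace ℝ (Fin n)))
    (hL : IsCompact L)
    (S : EuclideanSpace ℝ (Fin n) × EuclideanSpace ℝ (Fin n) → ℝ)
    (Sk : ℕ → EuclideanSpace ℝ (Fin n) × EuclideanSpace ℝ (Fin n) → ℝ)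
    (hS : ContDiff ℝ 1 S) (hSk : ∀ k, ContDiff ℝ 1 (Sk k))
    (hSsupp : tsupport S ⊆ L) (hSksupp : ∀ k, tsupport (Sk k) ⊆ L)
    (hSinj : AdmissibleInj S) (hSkinj : ∀ k, AdmissibleInj (Sk k))
    (φ : (EuclideanSpace ℝ (Fin n) × EuclideanSpace ℝ (Fin n)) ≃ₜ
         (EuclideanSpace ℝ (Fin n) × EuclideanSpace ℝ (Fin n)))
    (φk : ℕ → (EuclideanSpace ℝ (Fin n) × EuclideanSpace ℝ (Fin n)) ≃ₜ
         (EuclideanSpace ℝ (Fin n) × EuclideanSpace ℝ (Fin n)))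
    (hφ : GeneratedBy S ⇑φ) (hφk : ∀ k, GeneratedBy (Sk k) ⇑(φk k))
    (hconv : TendstoUniformly (fun k => fderiv ℝ (Sk k)) (fderiv ℝ S) atTop) :
    TendstoUniformly (fun k => ⇑(φk k)) (⇑φ) atTop := by
  have hd := hS.differentiable one_ne_zero
  have hdk := fun k => (hSk k).differentiable one_ne_zero
  have huc : UniformContinuous φ := φ.continuous.uniformContinuous_of_eq_self_off_compact hL
    fun p hp => hφ.eq_self_of_notMem_tsupport hd fun hmem => hp (hSsupp hmem)
  rw [Metric.tendstoUniformly_iff] at hconv ⊢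
  intro ε hε
  obtain ⟨δ, hδ, hφδ⟩ := Metric.uniformContinuous_iff.1 huc (ε / 2) (by positivity)
  filter_upwards [hconv (min δ (ε / 2)) (by positivity)] with k hk
  rintro ⟨x, y⟩
  obtain ⟨η, rfl⟩ := surjective_add_gradient_partial_fst (hSk k)
    (hL.of_isClosed_subset (isClosed_tsupport _) (hSksupp k)) x y
  have hkx := hk (x, η)
  have h1 : dist (φ (x, η + gradient (fun x' => Sk k (x', η)) x))
      (φ (x, η + gradient (fun x' => S (x', η)) x)) < ε / 2 := by
    apply hφδ
    rw [Prod.dist_eq, dist_self, dist_add_left, max_eq_right dist_nonneg, dist_comm]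
    exact (dist_gradient_partial_fst_le hd (hdk k) x η).trans_lt (hkx.trans_le (min_le_left _ _))
  have h2 : dist (φ (x, η + gradient (fun x' => S (x', η)) x))
      (φk k (x, η + gradient (fun x' => Sk k (x', η)) x)) < ε / 2 := by
    rw [hφ x η, hφk k x η, Prod.dist_eq, dist_self, dist_add_left, max_eq_left dist_nonneg]
    exact (dist_gradient_partial_snd_le hd (hdk k) x η).trans_lt (hkx.trans_le (min_le_right _ _))
  exact (dist_triangle _ _ _).trans_lt (by linarith)
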